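/- Every subgraph S of K_{11/4} with at least one edge satisfies b(S) > 17/22, while s(K_2, K_{11/4}) = 17/22. Consequently the identity χ_q(G) = 1/min_{S ⊆ G} b(S) fails for G = K_{11/4}, i.e. s(K_2, K_{11/4}) < min over subgraphs S of K_{11/4} with at least one edge of b(S). -/

import Mathlib

open scoped Classical

noncomputable section

/-- The circular complete graph `K_{p/q}`: vertices `v_0, …, v_{p-1}` with an edge
`v_i v_j` whenever `q ≤ |i - j| ≤ p - q`. -/
def circK (p q : ℕ) : SimpleGraph (Fin p) :=
  SimpleGraph.fromRel (fun i j =>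
    q ≤ max i.val j.val - min i.val j.val ∧ max i.val j.val - min i.val j.val ≤ p - q)

/-- The complete graph on two vertices. -/
def K2 : SimpleGraph (Fin 2) := ⊤

/-- The cycle graph on `n` vertices. -/
def cycleG (n : ℕ) : SimpleGraph (Fin n) :=
  SimpleGraph.fromRel (fun i j => (i.val + 1) % n = j.val)

/-- The total weight of the edges of `G` carried to edges of `H` by the vertex map `f`. -/
def cutWeight {α β : Type} [Fintype α] (G : SimpleGraph α) (H : SimpleGraph β)
    (w : Sym2 α → ℚ) (f : α → β) : ℝ :=
  ∑ e ∈ Finset.univ.filter (fun e : Sym2 α => e ∈ G.edgeSet ∧ Sym2.map f e ∈ H.edgeSet), (w e : ℝ)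

/-- `mc_H(G,w)`: the maximum over all vertex maps `f : V(G) → V(H)` of the total weight
of the edges of `G` mapped to edges of `H`. -/
def mcMax {α β : Type} [Fintype α] (H : SimpleGraph β) (G : SimpleGraph α)
    (w : Sym2 α → ℚ) : ℝ :=
  ⨆ f : α → β, cutWeight G H w f

/-- `s(M,N)`: the infimum over all finite simple graphs `G` with at least one edge and all
positive rational edge-weight functions `w` of `mc_M(G,w)/mc_N(G,w)`. -/
def sVal {α β : Type} (M : SimpleGraph α) (N : SimpleGraph β) : ℝ :=
  sInf { x : ℝ | ∃ (n : ℕ) (G : SimpleGraph (Fin n)) (w : Sym2 (Fin n) → ℚ),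
    G.edgeSet.Nonempty ∧ (∀ e ∈ G.edgeSet, 0 < w e) ∧
    x = mcMax M G w / mcMax N G w }

/-- The maximum size of a cut of `G`. -/
def maxCut {V : Type} [Fintype V] (G : SimpleGraph V) : ℕ :=
  Finset.univ.sup (fun f : V → Bool =>
    (Finset.univ.filter (fun e : Sym2 V => e ∈ G.edgeSet ∧ ¬ (Sym2.map f e).IsDiag)).card)

/-- The bipartite density of `G`: the maximum size of a cut divided by the number of edges. -/
def bDensity {V : Type} [Fintype V] (G : SimpleGraph V) : ℝ :=
  (maxCut G : ℝ) / ((Finset.univ.filter (fun e : Sym2 V => e ∈ G.edgeSet)).card : ℝ)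

def cutFn (k : Fin 44) (i : Fin 11) : Bool :=
  Nat.testBit (if k.val < 33 then 31 else 301) ((i.val + k.val) % 11)

lemma circK_adj (i j : Fin 11) : (circK 11 4).Adj i j ↔
    (j = i + 4 ∨ i = j + 4 ∨ j = i + 5 ∨ i = j + 5) := by
  unfold circK
  rw [SimpleGraph.fromRel_adj]
  revert i j
  decide

lemma cut_count : ∀ i j : Fin 11, (j = i + 4 ∨ i = j + 4 ∨ j = i + 5 ∨ i = j + 5) →
    (Finset.univ.filter (fun k : Fin 44 => cutFn k i ≠ cutFn k j)).card = 34 := by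
  decide +kernel

lemma cut_count' (e : Sym2 (Fin 11)) (he : e ∈ (circK 11 4).edgeSet) :
    (Finset.univ.filter (fun k : Fin 44 => ¬ (Sym2.map (cutFn k) e).IsDiag)).card = 34 := by
  induction e with
  | _ i j =>
    rw [SimpleGraph.mem_edgeSet, circK_adj] at he
    rw [← cut_count i j he]
    congr 1
    ext k
    simp

lemma avg {α : Type} (E : Finset (Sym2 α)) (w : Sym2 α → ℝ) (f : α → Fin 11)
    (hE : ∀ e ∈ E, Sym2.map f e ∈ (circK 11 4).edgeSet) :
    ∃ g : Fin 11 → Bool, 17 * ∑ e ∈ E, w e ≤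
      22 * ∑ e ∈ E.filter (fun e => ¬ (Sym2.map (g ∘ f) e).IsDiag), w e := by
  by_contra! h
  have h1 : ∑ k : Fin 44, 22 * ∑ e ∈ E.filter
      (fun e => ¬ (Sym2.map (cutFn k ∘ f) e).IsDiag), w e
      < ∑ k : Fin 44, 17 * ∑ e ∈ E, w e :=
    Finset.sum_lt_sum_of_nonempty Finset.univ_nonempty (fun k _ => h (cutFn k))
  have h2 : ∑ k : Fin 44, ∑ e ∈ E.filter
      (fun e => ¬ (Sym2.map (cutFn k ∘ f) e).IsDiag), w e = 34 * ∑ e ∈ E, w e := by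
    simp_rw [Finset.sum_filter]
    rw [Finset.sum_comm, Finset.mul_sum]
    refine Finset.sum_congr rfl fun e he => ?_
    rw [← Finset.sum_filter, Finset.sum_const, nsmul_eq_mul]
    have := cut_count' _ (hE e he)
    simp only [Sym2.map_map] at this
    rw [this]
    norm_num
  rw [← Finset.mul_sum, h2] at h1
  simp at h1
  linarith

def bf : Bool → Fin 2 := fun b => if b then 1 else 0

lemma K2_mem (e : Sym2 (Fin 2)) : e ∈ K2.edgeSet ↔ ¬ e.IsDiag := by
  induction e with
  | _ i j => simp [K2]

lemma bf_mem (e : Sym2 Bool) : Sym2.map bf e ∈ K2.edgeSet ↔ ¬ e.IsDiag := by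
  rw [K2_mem]
  induction e with
  | _ i j => cases i <;> cases j <;> simp [bf]

lemma le_mc {α β : Type} [Fintype α] [Finite β] (H : SimpleGraph β) (G : SimpleGraph α)
    (w : Sym2 α → ℚ) (f : α → β) : cutWeight G H w f ≤ mcMax H G w :=
  le_ciSup (f := fun f : α → β => cutWeight G H w f) (Set.finite_range _).bddAbove f

lemma lower {n : ℕ} (G : SimpleGraph (Fin n)) (w : Sym2 (Fin n) → ℚ)
    (hw : ∀ e ∈ G.edgeSet, 0 < w e) :
    17 * mcMax (circK 11 4) G w ≤ 22 * mcMax K2 G w := by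
  obtain ⟨f, hf⟩ := exists_eq_ciSup_of_finite
    (f := fun f : Fin n → Fin 11 => cutWeight G (circK 11 4) w f)
  have hf' : mcMax (circK 11 4) G w = cutWeight G (circK 11 4) w f := hf.symm
  obtain ⟨g, hg⟩ := avg (Finset.univ.filter (fun e : Sym2 (Fin n) =>
    e ∈ G.edgeSet ∧ Sym2.map f e ∈ (circK 11 4).edgeSet)) (fun e => (w e : ℝ)) f (by
      intro e he
      simp only [Finset.mem_filter, Finset.mem_univ, true_and] at he
      exact he.2)
  rw [hf']
  refine le_trans hg ?_
  refine mul_le_mul_of_nonneg_left ?_ (by norm_num)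
  refine le_trans ?_ (le_mc K2 G w (bf ∘ g ∘ f))
  unfold cutWeight
  refine Finset.sum_le_sum_of_subset_of_nonneg ?_ ?_
  · intro e he
    simp only [Finset.mem_filter, Finset.mem_univ, true_and] at he ⊢
    refine ⟨he.1.1, ?_⟩
    rw [← Sym2.map_map, bf_mem]
    exact he.2
  · intro e he _
    simp only [Finset.mem_filter, Finset.mem_univ, true_and] at he
    exact_mod_cast (hw e he.1).le

def Eset : Finset (Sym2 (Fin 11)) :=
  Finset.univ.image (fun i : Fin 11 => s(i, i + 4)) ∪
  Finset.univ.image (fun i : Fin 11 => s(i, i + 5))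

lemma Eset_mem (e : Sym2 (Fin 11)) : e ∈ (circK 11 4).edgeSet ↔ e ∈ Eset := by
  induction e with
  | _ i j =>
    rw [SimpleGraph.mem_edgeSet, circK_adj]
    revert i j
    unfold Eset
    decide +kernel

lemma Eset_card : Eset.card = 22 := by
  unfold Eset
  decide +kernel

lemma big_cut : 18 ≤ (Eset.filter (fun e => ¬ (Sym2.map (cutFn 0) e).IsDiag)).card := by
  unfold Eset
  decide +kernel

lemma le_maxCut {V : Type} [Fintype V] (G : SimpleGraph V) (g : V → Bool) :
    (Finset.univ.filter (fun e : Sym2 V =>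
      e ∈ G.edgeSet ∧ ¬ (Sym2.map g e).IsDiag)).card ≤ maxCut G := by
  unfold maxCut
  exact Finset.le_sup (f := fun f : V → Bool => (Finset.univ.filter (fun e : Sym2 V =>
    e ∈ G.edgeSet ∧ ¬ (Sym2.map f e).IsDiag)).card) (Finset.mem_univ g)

lemma part1 (S : SimpleGraph (Fin 11)) (hS : S ≤ circK 11 4) (hne : S.edgeSet.Nonempty) :
    (17 : ℝ)/22 < bDensity S := by
  have hmc : ∀ g : Fin 11 → Bool, (Finset.univ.filter (fun e : Sym2 (Fin 11) =>
      e ∈ S.edgeSet ∧ ¬ (Sym2.map g e).IsDiag)).card ≤ maxCut S := fun g =>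
    (le_of_eq (by congr)).trans (le_maxCut S g)
  unfold bDensity
  set E := Finset.univ.filter (fun e : Sym2 (Fin 11) => e ∈ S.edgeSet) with hE
  have hsub : E ⊆ Eset := by
    intro e he
    rw [← Eset_mem]
    simp only [hE, Finset.mem_filter, Finset.mem_univ, true_and] at he
    exact SimpleGraph.edgeSet_mono hS he
  have hpos : 0 < E.card := by
    obtain ⟨e, he⟩ := hne
    exact Finset.card_pos.2 ⟨e, Finset.mem_filter.2 ⟨Finset.mem_univ _, he⟩⟩
  have hle : E.card ≤ 22 := le_of_le_of_eq (Finset.card_le_card hsub) Eset_card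
  have hfil : ∀ g : Fin 11 → Bool,
      (E.filter (fun e => ¬ (Sym2.map g e).IsDiag)).card ≤ maxCut S := by
    intro g
    rw [hE, Finset.filter_filter]
    exact hmc g
  obtain ⟨g, hg⟩ := avg E (fun _ => 1) id (fun e he => by
    rw [Sym2.map_id]; exact (Eset_mem _).2 (hsub he))
  have hg2 : 17 * E.card ≤ 22 * (E.filter (fun e => ¬ (Sym2.map g e).IsDiag)).card := by
    simp only [Finset.sum_const, nsmul_eq_mul, mul_one, Function.comp_id] at hg
    exact_mod_cast hg
  have h1 := hfil g
  have key : 17 * E.card < 22 * maxCut S := by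
    by_cases h22 : E.card = 22
    · have heq : E = Eset := Finset.eq_of_subset_of_card_le hsub (by rw [Eset_card, h22])
      have h2 := hfil (cutFn 0)
      rw [heq] at h2
      have h3 := big_cut
      have h4 : 18 ≤ maxCut S := le_trans (by convert h3) h2
      omega
    · omega
  rw [div_lt_div_iff₀ (by norm_num) (by exact_mod_cast hpos)]
  have : (17 : ℝ) * E.card < 22 * maxCut S := by exact_mod_cast key
  linarith

def wt : Sym2 (Fin 11) → ℚ := fun e =>
  if e ∈ Finset.univ.image (fun i : Fin 11 => s(i, i + 4)) then 3 else 1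

lemma Eset_sum (F : Sym2 (Fin 11) → ℝ) :
    ∑ e ∈ Eset, (wt e : ℝ) * F e = ∑ i : Fin 11, (3 * F s(i, i + 4) + F s(i, i + 5)) := by
  unfold Eset
  rw [Finset.sum_union (by decide +kernel), Finset.sum_image (by decide +kernel),
    Finset.sum_image (by decide +kernel), Finset.sum_add_distrib]
  refine congrArg₂ (fun a b : ℝ => a + b) ?_ ?_
  · refine Finset.sum_congr rfl fun i _ => ?_
    have : wt s(i, i+4) = 3 := if_pos (Finset.mem_image_of_mem _ (Finset.mem_univ i))
    rw [this]; norm_num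
  · refine Finset.sum_congr rfl fun i _ => ?_
    have : wt s(i, i+5) = 1 := if_neg (by revert i; decide +kernel)
    rw [this]; norm_num

lemma cw_eq {β : Type} (H : SimpleGraph β) (f : Fin 11 → β) :
    cutWeight (circK 11 4) H wt f =
      ∑ i : Fin 11, (3 * (if H.Adj (f i) (f (i+4)) then (1:ℝ) else 0)
        + (if H.Adj (f i) (f (i+5)) then (1:ℝ) else 0)) := by
  unfold cutWeight
  have := Eset_sum (fun e => if Sym2.map f e ∈ H.edgeSet then 1 else 0)
  simp only [Sym2.map_mk, SimpleGraph.mem_edgeSet] at this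
  rw [← this, ← Finset.filter_filter]
  have h2 : Finset.univ.filter (fun e : Sym2 (Fin 11) => e ∈ (circK 11 4).edgeSet) = Eset := by
    ext e; simp [← Eset_mem]
  rw [h2, Finset.sum_filter]
  refine Finset.sum_congr rfl fun e _ => ?_
  split_ifs <;> simp

def ct (a b : Fin 2) : ℕ := if a = b then 0 else 1

lemma cut_le : ∀ f0 f1 f2 f3 f4 f5 f6 f7 f8 f9 f10 : Fin 2,
    3 * (ct f0 f4 + ct f1 f5 + ct f2 f6 + ct f3 f7 + ct f4 f8 + ct f5 f9 + ct f6 f10 +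
      ct f7 f0 + ct f8 f1 + ct f9 f2 + ct f10 f3) +
    (ct f0 f5 + ct f1 f6 + ct f2 f7 + ct f3 f8 + ct f4 f9 + ct f5 f10 + ct f6 f0 +
      ct f7 f1 + ct f8 f2 + ct f9 f3 + ct f10 f4) ≤ 34 := by
  decide +kernel

lemma upper2 : mcMax K2 (circK 11 4) wt ≤ 34 := by
  refine ciSup_le fun f => ?_
  rw [cw_eq]
  have hct : ∀ a b : Fin 2, (if K2.Adj a b then (1:ℝ) else 0) = (ct a b : ℝ) := by
    intro a b
    unfold ct K2
    by_cases h : a = b <;> simp [h]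
  simp_rw [hct]
  have h := cut_le (f 0) (f 1) (f 2) (f 3) (f 4) (f 5) (f 6) (f 7) (f 8) (f 9) (f 10)
  have h' : ∑ i : Fin 11, (3 * ct (f i) (f (i+4)) + ct (f i) (f (i+5))) ≤ 34 := by
    refine le_trans (le_of_eq ?_) h
    simp only [Fin.sum_univ_succ, Fin.sum_univ_zero]
    have e : ∀ i j : Fin 11, i = j → f i = f j := fun i j h => by rw [h]
    change 3 * ct (f 0) (f 4) + ct (f 0) (f 5) + (3 * ct (f 1) (f 5) + ct (f 1) (f 6) +
      (3 * ct (f 2) (f 6) + ct (f 2) (f 7) + (3 * ct (f 3) (f 7) + ct (f 3) (f 8) +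
      (3 * ct (f 4) (f 8) + ct (f 4) (f 9) + (3 * ct (f 5) (f 9) + ct (f 5) (f 10) +
      (3 * ct (f 6) (f 10) + ct (f 6) (f 0) + (3 * ct (f 7) (f 0) + ct (f 7) (f 1) +
      (3 * ct (f 8) (f 1) + ct (f 8) (f 2) + (3 * ct (f 9) (f 2) + ct (f 9) (f 3) +
      (3 * ct (f 10) (f 3) + ct (f 10) (f 4) + 0)))))))))) = _
    ring
  exact_mod_cast h'

lemma lower11 : 44 ≤ mcMax (circK 11 4) (circK 11 4) wt := by
  refine le_trans (le_of_eq ?_) (le_mc _ _ _ id)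
  rw [cw_eq]
  have h4 : ∀ i : Fin 11, (circK 11 4).Adj (id i) (id (i+4)) := fun i => by
    rw [circK_adj]; simp
  have h5 : ∀ i : Fin 11, (circK 11 4).Adj (id i) (id (i+5)) := fun i => by
    rw [circK_adj]; simp
  simp only [h4, h5, if_true]
  norm_num

lemma mc_pos {n : ℕ} (G : SimpleGraph (Fin n)) (w : Sym2 (Fin n) → ℚ)
    (hne : G.edgeSet.Nonempty) (hw : ∀ e ∈ G.edgeSet, 0 < w e) :
    0 < mcMax (circK 11 4) G w := by
  obtain ⟨e, he⟩ := hne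
  induction e with
  | _ a b =>
    have hab : a ≠ b := (SimpleGraph.mem_edgeSet _ |>.1 he).ne
    refine lt_of_lt_of_le ?_ (le_mc _ _ _ (fun x => if x = a then (0 : Fin 11) else 4))
    refine Finset.sum_pos ?_ ⟨s(a, b), ?_⟩
    · intro e he
      simp only [Finset.mem_filter, Finset.mem_univ, true_and] at he
      exact_mod_cast hw e he.1
    · simp only [Finset.mem_filter, Finset.mem_univ, true_and]
      refine ⟨he, ?_⟩
      rw [Sym2.map_mk, SimpleGraph.mem_edgeSet, circK_adj]
      simp [hab.symm]

lemma part2 : sVal K2 (circK 11 4) = (17 : ℝ)/22 := by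
  have hlow : ∀ {n : ℕ} (G : SimpleGraph (Fin n)) (w : Sym2 (Fin n) → ℚ),
      G.edgeSet.Nonempty → (∀ e ∈ G.edgeSet, 0 < w e) →
      (17 : ℝ)/22 ≤ mcMax K2 G w / mcMax (circK 11 4) G w := by
    intro n G w hne hw
    rw [div_le_div_iff₀ (by norm_num) (mc_pos G w hne hw)]
    linarith [lower G w hw]
  have hne : (circK 11 4).edgeSet.Nonempty := ⟨s(0, 4), by
    rw [SimpleGraph.mem_edgeSet, circK_adj]; simp⟩
  have hw : ∀ e ∈ (circK 11 4).edgeSet, 0 < wt e := by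
    intro e _
    unfold wt
    split_ifs <;> norm_num
  refine IsLeast.csInf_eq ⟨⟨11, circK 11 4, wt, hne, hw, ?_⟩, ?_⟩
  · refine le_antisymm (hlow _ _ hne hw) ?_
    rw [div_le_div_iff₀ (mc_pos _ _ hne hw) (by norm_num)]
    linarith [upper2, lower11]
  · rintro x ⟨n, G, w, h1, h2, rfl⟩
    exact hlow G w h1 h2

theorem stmt11 :
    (∀ S : SimpleGraph (Fin 11), S ≤ circK 11 4 → S.edgeSet.Nonempty →
      (17 : ℝ)/22 < bDensity S) ∧
    sVal K2 (circK 11 4) = (17 : ℝ)/22 ∧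
    (∀ S : SimpleGraph (Fin 11), S ≤ circK 11 4 → S.edgeSet.Nonempty →
      sVal K2 (circK 11 4) < bDensity S) := by
  refine ⟨part1, part2, fun S hS hne => ?_⟩
  rw [part2]
  exact part1 S hS hne
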